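/- Let Q and Q' be finite quivers and F: mod(Q) -> mod(Q') an exact k-linear functor between the categories of finite-dimensional representations over k = F_q such that for all representations U, V of Q, the induced map Ext^1_Q(U,V) -> Ext^1_{Q'}(F(U), F(V)) is surjective with all fibres of the same cardinality. Let H(Q) and H(Q') be the twisted completed Hall algebras with multiplication [U][V] = Sum_{[W]} q^{<dim U, dim V>_a} F_{UV}^W [W]. Then the linear map H(F)_*: H(Q) -> H(Q') defined by [M] -> (a_{F(M)} / a_M) [F(M)] is an algebra homomorphism. -/

import Mathlib

/- Common setup: finite quivers, finite-dimensional representations over a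
finite field, subrepresentations, quotients, Hall numbers, quiver
Grassmannians and flags, extensions, and the (completed) Hall algebra,
following J. Fei, "Counting using Hall algebras I. Quivers". -/

open scoped BigOperators

attribute [local instance] Classical.propDecidable

namespace HallPaper

/-- A finite quiver: finitely many vertices and arrows. -/
structure FinQuiver where
  V : Type
  A : Type
  [fV : Fintype V]
  [fA : Fintype A]
  src : A → V
  tgt : A → V

attribute [instance] FinQuiver.fV FinQuiver.fA

/-- The additive Euler form `⟨α,β⟩_a = ∑_v α(v)β(v) - ∑_a α(ta)β(ha)`. -/
def eulerForm (Q : FinQuiver) (α β : Q.V → ℤ) : ℤ :=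
  (∑ v, α v * β v) - ∑ a, α (Q.src a) * β (Q.tgt a)

/-- The additive Euler form on dimension vectors. -/
def eulerFormN (Q : FinQuiver) (α β : Q.V → ℕ) : ℤ :=
  eulerForm Q (fun v => (α v : ℤ)) (fun v => (β v : ℤ))

/-- `Q` has no oriented cycles. -/
def NoCycles (Q : FinQuiver) : Prop :=
  ¬ ∃ (n : ℕ) (c : Fin (n + 1) → Q.A),
      (∀ i : Fin n, Q.tgt (c i.castSucc) = Q.src (c i.succ)) ∧
      Q.tgt (c (Fin.last n)) = Q.src (c 0)

/-- A finite-dimensional representation of a finite quiver `Q` over `k`. -/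
structure QRep (Q : FinQuiver) (k : Type) [Field k] where
  space : Q.V → Type
  [acg : ∀ v, AddCommGroup (space v)]
  [mod : ∀ v, Module k (space v)]
  [fd : ∀ v, FiniteDimensional k (space v)]
  map : ∀ a : Q.A, space (Q.src a) →ₗ[k] space (Q.tgt a)

attribute [instance] QRep.acg QRep.mod QRep.fd

namespace QRep

variable {Q : FinQuiver} {k : Type} [Field k]

/-- The dimension vector of a representation. -/
noncomputable def dimVec (M : QRep Q k) : Q.V → ℕ :=
  fun v => Module.finrank k (M.space v)

/-- A morphism of quiver representations. -/
structure Hom (M N : QRep Q k) where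
  app : ∀ v, M.space v →ₗ[k] N.space v
  comm : ∀ (a : Q.A) (x : M.space (Q.src a)),
    app (Q.tgt a) (M.map a x) = N.map a (app (Q.src a) x)

/-- The identity morphism. -/
def Hom.id (M : QRep Q k) : Hom M M :=
  ⟨fun _ => LinearMap.id, fun _ _ => rfl⟩

/-- Composition of morphisms. -/
def Hom.comp {M N P : QRep Q k} (g : Hom N P) (f : Hom M N) : Hom M P :=
  ⟨fun v => (g.app v).comp (f.app v), fun a x => by
    simp only [LinearMap.comp_apply, f.comm, g.comm]⟩

/-- An isomorphism of quiver representations. -/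
structure Iso (M N : QRep Q k) where
  app : ∀ v, M.space v ≃ₗ[k] N.space v
  comm : ∀ (a : Q.A) (x : M.space (Q.src a)),
    app (Q.tgt a) (M.map a x) = N.map a (app (Q.src a) x)

/-- Two representations are isomorphic. -/
def IsIsomorphic (M N : QRep Q k) : Prop := Nonempty (Iso M N)

/-- `a_M`, the number of automorphisms of `M`. -/
noncomputable def autCard (M : QRep Q k) : ℕ := Nat.card (Iso M M)

/-- `|Hom_Q(M,N)|`. -/
noncomputable def homCard (M N : QRep Q k) : ℕ := Nat.card (Hom M N)

/-- A subrepresentation: a family of subspaces stable under all arrow maps. -/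
structure SubRep (M : QRep Q k) where
  sub : ∀ v, Submodule k (M.space v)
  stable : ∀ (a : Q.A) (x : M.space (Q.src a)),
    x ∈ sub (Q.src a) → M.map a x ∈ sub (Q.tgt a)

namespace SubRep

variable {M : QRep Q k}

/-- A subrepresentation as a representation in its own right. -/
def toRep (L : SubRep M) : QRep Q k where
  space := fun v => L.sub v
  acg := fun _ => inferInstance
  mod := fun _ => inferInstance
  fd := fun _ => inferInstance
  map := fun a => (M.map a).restrict (fun x hx => L.stable a x hx)

/-- The quotient representation `M/L`. -/
def quotRep (L : SubRep M) : QRep Q k where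
  space := fun v => M.space v ⧸ L.sub v
  acg := fun _ => inferInstance
  mod := fun _ => inferInstance
  fd := fun _ => inferInstance
  map := fun a => Submodule.mapQ _ _ (M.map a) (fun x hx => L.stable a x hx)

/-- The dimension vector of a subrepresentation. -/
noncomputable def dim (L : SubRep M) : Q.V → ℕ :=
  fun v => Module.finrank k (L.sub v)

/-- The zero subrepresentation predicate. -/
def IsZero (L : SubRep M) : Prop := ∀ v, L.sub v = ⊥

/-- The full subrepresentation predicate. -/
def IsFull (L : SubRep M) : Prop := ∀ v, L.sub v = ⊤

/-- Containment of subrepresentations. -/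
def le (L L' : SubRep M) : Prop := ∀ v, L.sub v ≤ L'.sub v

/-- The subquotient `L'/L` of two nested subrepresentations. -/
def subquot (L L' : SubRep M) (h : L.le L') : QRep Q k where
  space := fun v => (L'.sub v) ⧸ ((L.sub v).comap (L'.sub v).subtype)
  acg := fun _ => inferInstance
  mod := fun _ => inferInstance
  fd := fun _ => inferInstance
  map := fun a =>
    Submodule.mapQ _ _ ((M.map a).restrict (fun x hx => L'.stable a x hx))
      (fun x hx => by
        have hx' : (x : M.space (Q.src a)) ∈ L.sub (Q.src a) := hx
        have := L.stable a x hx'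
        simpa [Submodule.mem_comap] using this)

end SubRep

/-- The number of points of the quiver Grassmannian `Gr_γ(M)`. -/
noncomputable def grCard (γ : Q.V → ℕ) (M : QRep Q k) : ℕ :=
  Nat.card {L : SubRep M // L.dim = γ}

/-- The Hall number `F_{UV}^W`: the number of subrepresentations `L ⊆ W`
with `L ≅ V` and `W/L ≅ U`. -/
noncomputable def hallNum (U V W : QRep Q k) : ℕ :=
  Nat.card {L : SubRep W // IsIsomorphic L.toRep V ∧ IsIsomorphic L.quotRep U}

/-- The number of points of the quiver flag variety `Fl_{α_t ⋯ α_1}(M)`;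
here `α i` is the dimension vector of the subquotient `L_{i+1}/L_i`. -/
noncomputable def flCard {t : ℕ} (α : Fin t → (Q.V → ℕ)) (M : QRep Q k) : ℕ :=
  Nat.card {L : Fin (t + 1) → SubRep M //
    (L 0).IsZero ∧ (L (Fin.last t)).IsFull ∧
    (∀ i : Fin t, (L i.castSucc).le (L i.succ)) ∧
    (∀ i : Fin t, ∀ v, (L i.succ).dim v = (L i.castSucc).dim v + α i v)}

/-- Cochains: the space whose quotient by coboundaries is `Ext¹_Q(U,V)`. -/
abbrev Cochain (U V : QRep Q k) :=
  ∀ a : Q.A, U.space (Q.src a) →ₗ[k] V.space (Q.tgt a)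

/-- The coboundary of a family of linear maps. -/
def coboundary {U V : QRep Q k} (f : ∀ v, U.space v →ₗ[k] V.space v) :
    Cochain U V :=
  fun a => (V.map a).comp (f (Q.src a)) - (f (Q.tgt a)).comp (U.map a)

/-- Two cochains define the same class in `Ext¹_Q(U,V)`. -/
def extRel (U V : QRep Q k) (z z' : Cochain U V) : Prop :=
  ∃ f, z' = z + coboundary f

/-- `|Ext¹_Q(U,V)|`. -/
noncomputable def ext1Card (U V : QRep Q k) : ℕ := Nat.card (Quot (extRel U V))

/-- The middle term of the extension of `U` by `V` defined by a cochain. -/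
def middle {U V : QRep Q k} (z : Cochain U V) : QRep Q k where
  space := fun v => V.space v × U.space v
  acg := fun _ => inferInstance
  mod := fun _ => inferInstance
  fd := fun _ => inferInstance
  map := fun a =>
    LinearMap.prod
      ((V.map a).comp (LinearMap.fst k _ _) + (z a).comp (LinearMap.snd k _ _))
      ((U.map a).comp (LinearMap.snd k _ _))

/-- `|Ext_Q(U,V)_W|`: the number of classes in `Ext¹_Q(U,V)` of extensions
with middle term isomorphic to `W`. -/
noncomputable def extWCard (U V W : QRep Q k) : ℕ :=
  Nat.card {e : Quot (extRel U V) //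
    ∃ z : Cochain U V, Quot.mk _ z = e ∧ IsIsomorphic (middle z) W}

/-- `T` is rigid, i.e. `Ext¹_Q(T,T) = 0`. -/
def IsRigid (T : QRep Q k) : Prop :=
  ∀ z : Cochain T T, ∃ f, z = coboundary f

/-- Direct sum of two representations. -/
def dsum (M N : QRep Q k) : QRep Q k where
  space := fun v => M.space v × N.space v
  acg := fun _ => inferInstance
  mod := fun _ => inferInstance
  fd := fun _ => inferInstance
  map := fun a => (M.map a).prodMap (N.map a)

/-- Finite direct sums of representations. -/
def dsumFin {ι : Type} [Fintype ι] (f : ι → QRep Q k) : QRep Q k where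
  space := fun v => ∀ i, (f i).space v
  acg := fun _ => inferInstance
  mod := fun _ => inferInstance
  fd := fun _ => inferInstance
  map := fun a => LinearMap.pi (fun i => ((f i).map a).comp (LinearMap.proj i))

/-- A simple representation. -/
def IsSimple (M : QRep Q k) : Prop :=
  M.dimVec ≠ 0 ∧ ∀ L : SubRep M, L.IsZero ∨ L.IsFull

/-- An indecomposable representation. -/
def Indecomposable (M : QRep Q k) : Prop :=
  M.dimVec ≠ 0 ∧
    ∀ A B : QRep Q k, IsIsomorphic M (dsum A B) → A.dimVec = 0 ∨ B.dimVec = 0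

end QRep

open QRep

/-- The affine space of `α`-dimensional representations: one matrix per arrow. -/
def StdRep (Q : FinQuiver) (k : Type) [Field k] (α : Q.V → ℕ) :=
  ∀ a : Q.A, Matrix (Fin (α (Q.tgt a))) (Fin (α (Q.src a))) k

instance (Q : FinQuiver) (k : Type) [Field k] [Fintype k] (α : Q.V → ℕ) :
    Finite (StdRep Q k α) := by
  unfold StdRep; infer_instance

/-- A point of `Rep_α(Q)` as an abstract representation. -/
def StdRep.toQRep {Q : FinQuiver} {k : Type} [Field k] {α : Q.V → ℕ}
    (W : StdRep Q k α) : QRep Q k where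
  space := fun v => Fin (α v) → k
  acg := fun _ => inferInstance
  mod := fun _ => inferInstance
  fd := fun _ => inferInstance
  map := fun a => Matrix.mulVecLin (W a)

/-- Isomorphism relation on `α`-dimensional representations. -/
def isoRel (Q : FinQuiver) (k : Type) [Field k] (α : Q.V → ℕ)
    (W W' : StdRep Q k α) : Prop :=
  IsIsomorphic W.toQRep W'.toQRep

/-- Isomorphism classes of `α`-dimensional representations of `Q` over `k`. -/
def IsoClass (Q : FinQuiver) (k : Type) [Field k] (α : Q.V → ℕ) :=
  Quot (isoRel Q k α)

/-- A representative representation of an isomorphism class. -/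
noncomputable def IsoClass.rep {Q : FinQuiver} {k : Type} [Field k]
    {α : Q.V → ℕ} (c : IsoClass Q k α) : QRep Q k :=
  (Quot.out c).toQRep

/-- Isomorphism classes of representations of all dimension vectors. -/
abbrev TotalClass (Q : FinQuiver) (k : Type) [Field k] :=
  Σ α : Q.V → ℕ, IsoClass Q k α

/-- A representative of a class in `TotalClass`. -/
noncomputable def TotalClass.rep {Q : FinQuiver} {k : Type} [Field k]
    (c : TotalClass Q k) : QRep Q k :=
  c.2.rep

section Counting

variable (Q : FinQuiver) (k : Type) [Field k] [Fintype k]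

/-- `|Rep_α(Q)(F_q)|`. -/
noncomputable def repCard (α : Q.V → ℕ) : ℕ := Nat.card (StdRep Q k α)

/-- `|GL_α(F_q)|`. -/
noncomputable def glCard (α : Q.V → ℕ) : ℕ :=
  Nat.card (∀ v : Q.V, Matrix.GeneralLinearGroup (Fin (α v)) k)

/-- `r_α(q) = |Rep_α(Q)| / |GL_α|`. -/
noncomputable def rFun (α : Q.V → ℕ) : ℚ :=
  (repCard Q k α : ℚ) / (glCard Q k α : ℚ)

end Counting

section Slope

variable {Q : FinQuiver}

/-- The value of a weight (`ℤ`-linear functional) on a dimension vector. -/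
def wt (σ : Q.V → ℤ) (α : Q.V → ℕ) : ℤ := ∑ v, σ v * α v

/-- The slope `μ(α) = σ(α)/θ(α)`. -/
noncomputable def slope (σ θ : Q.V → ℤ) (α : Q.V → ℕ) : ℚ :=
  (wt σ α : ℚ) / (wt θ α : ℚ)

/-- `θ` is positive on all nonzero dimension vectors (so `σ/θ` is a slope
function). -/
def SlopeOK (θ : Q.V → ℤ) : Prop :=
  ∀ α : Q.V → ℕ, α ≠ 0 → 0 < wt θ α

variable {k : Type} [Field k]

/-- `μ`-semistability. -/
def IsSemistable (σ θ : Q.V → ℤ) (M : QRep Q k) : Prop :=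
  ∀ L : SubRep M, ¬ L.IsZero → ¬ L.IsFull →
    slope σ θ L.dim ≤ slope σ θ M.dimVec

/-- `μ`-stability. -/
def IsStable (σ θ : Q.V → ℤ) (M : QRep Q k) : Prop :=
  ∀ L : SubRep M, ¬ L.IsZero → ¬ L.IsFull →
    slope σ θ L.dim < slope σ θ M.dimVec

/-- `μ` is coprime to `α`: `μ(γ) ≠ μ(α)` for all `0 < γ < α`. -/
def Coprime (σ θ : Q.V → ℤ) (α : Q.V → ℕ) : Prop :=
  ∀ γ : Q.V → ℕ, γ ≠ 0 → γ ≤ α → γ ≠ α → slope σ θ γ ≠ slope σ θ α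

end Slope

section Decomp

variable {Q : FinQuiver}

/-- Ordered decompositions `α = α_1 + ⋯ + α_s` into nonzero dimension vectors
with strictly increasing slopes (Harder–Narasimhan type). -/
structure HNDecomp (σ θ : Q.V → ℤ) (α : Q.V → ℕ) where
  s : ℕ
  pos : 0 < s
  d : Fin s → (Q.V → ℕ)
  nonzero : ∀ i, d i ≠ 0
  total : ∑ i, d i = α
  incr : ∀ i j : Fin s, i < j → slope σ θ (d i) < slope σ θ (d j)

/-- Ordered decompositions `α = α_1 + ⋯ + α_s` into nonzero dimension vectors
with `μ(α_1 + ⋯ + α_k) < μ(α)` for all `k < s`. -/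
structure StarDecomp (σ θ : Q.V → ℤ) (α : Q.V → ℕ) where
  s : ℕ
  pos : 0 < s
  d : Fin s → (Q.V → ℕ)
  nonzero : ∀ i, d i ≠ 0
  total : ∑ i, d i = α
  partial_lt : ∀ kk : Fin s, (kk : ℕ) + 1 < s →
    slope σ θ (∑ i ∈ Finset.Iic kk, d i) < slope σ θ α

end Decomp

section Hall

variable (Q : FinQuiver) (k : Type) [Field k]

/-- The underlying space of the completed Hall algebra: formal (possibly
infinite) linear combinations of isomorphism classes. -/
abbrev HallAlg := TotalClass Q k → ℚ

/-- The Hall product `[U][V] = ∑_{[W]} F_{UV}^W [W]`, written on coefficient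
functions. -/
noncomputable def hallMul (x y : HallAlg Q k) : HallAlg Q k :=
  fun W => ∑ᶠ (U : TotalClass Q k) (V : TotalClass Q k),
    x U * y V * (hallNum U.rep V.rep W.rep : ℚ)

/-- The unit `[0]` of the Hall algebra. -/
noncomputable def hallOne : HallAlg Q k :=
  fun c => if c.1 = 0 then 1 else 0

/-- Iterated Hall product of a list. -/
noncomputable def hallProd (l : List (HallAlg Q k)) : HallAlg Q k :=
  l.foldr (hallMul Q k) (hallOne Q k)

/-- The twisted Hall product `[U][V] = ∑_{[W]} q^{⟨dim U, dim V⟩} F_{UV}^W [W]`. -/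
noncomputable def hallMulTw [Fintype k] (x y : HallAlg Q k) : HallAlg Q k :=
  fun W => ∑ᶠ (U : TotalClass Q k) (V : TotalClass Q k),
    x U * y V * ((Fintype.card k : ℚ) ^ eulerFormN Q U.rep.dimVec V.rep.dimVec) *
      (hallNum U.rep V.rep W.rep : ℚ)

/-- `χ_α`, the sum of all `[M]` with `dim M = α`. -/
noncomputable def chiElt (α : Q.V → ℕ) : HallAlg Q k :=
  fun c => if c.1 = α then 1 else 0

/-- `χ_α^{ss}`, the sum of all semistable `[M]` with `dim M = α`. -/
noncomputable def chiSS (σ θ : Q.V → ℤ) (α : Q.V → ℕ) : HallAlg Q k :=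
  fun c => if c.1 = α ∧ IsSemistable σ θ c.rep then 1 else 0

/-- The completed quantum polynomial algebra `P_{⟨Q⟩}` (coefficient functions
on monomials `t^α`). -/
abbrev QPoly := (Q.V → ℕ) → ℚ

/-- Multiplication `t^α t^β = q^{-⟨α,β⟩_a} t^{α+β}` of `P_{⟨Q⟩}`. -/
noncomputable def qpolyMul [Fintype k] (x y : QPoly Q) : QPoly Q :=
  fun α => ∑ᶠ (β : Q.V → ℕ) (γ : Q.V → ℕ),
    if β + γ = α then
      ((Fintype.card k : ℚ) ^ (-(eulerFormN Q β γ))) * x β * y γ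
    else 0

/-- The unit of `P_{⟨Q⟩}`. -/
noncomputable def qpolyOne : QPoly Q :=
  fun α => if α = 0 then 1 else 0

/-- The integration map `∫ : H(Q) → P_{⟨Q⟩}`, `[M] ↦ a_M⁻¹ t^{dim M}`. -/
noncomputable def intChar (x : HallAlg Q k) : QPoly Q :=
  fun α => ∑ᶠ c : IsoClass Q k α, x ⟨α, c⟩ / (autCard (IsoClass.rep c) : ℚ)

end Hall

section Chains

variable {Q : FinQuiver} {k : Type} [Field k]

/-- The number of strict chains `0 = W_0 < W_1 < ⋯ < W_i = W` of
subrepresentations. -/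
noncomputable def chainCount (M : QRep Q k) (i : ℕ) : ℕ :=
  Nat.card {L : Fin (i + 1) → SubRep M //
    (L 0).IsZero ∧ (L (Fin.last i)).IsFull ∧
    ∀ j : Fin i, (L j.castSucc).le (L j.succ) ∧
      (L j.castSucc).sub ≠ (L j.succ).sub}

/-- `F_W = ∑_i (-1)^i F_i(W)`, the alternating sum of numbers of strict
chains of subrepresentations. -/
noncomputable def FW (M : QRep Q k) : ℚ :=
  ∑ᶠ i : ℕ, (-1 : ℚ) ^ i * (chainCount M i : ℚ)

end Chains

/-- A pair of composable morphisms forming a short exact sequence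
`0 → A → B → C → 0` (vertexwise). -/
def IsSESpair {Q : FinQuiver} {k : Type} [Field k] {A B C : QRep Q k}
    (f : QRep.Hom A B) (g : QRep.Hom B C) : Prop :=
  ∀ v, Function.Injective (f.app v) ∧ Function.Surjective (g.app v) ∧
    LinearMap.range (f.app v) = LinearMap.ker (g.app v)

/-- An exact `k`-linear functor `mod(Q) → mod(Q')`. -/
structure RepFunctor (Q Q' : FinQuiver) (k : Type) [Field k] where
  obj : QRep Q k → QRep Q' k
  map : ∀ {M N : QRep Q k}, QRep.Hom M N → QRep.Hom (obj M) (obj N)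
  map_id : ∀ M : QRep Q k, map (QRep.Hom.id M) = QRep.Hom.id (obj M)
  map_comp : ∀ {M N P : QRep Q k} (f : QRep.Hom M N) (g : QRep.Hom N P),
    map (g.comp f) = (map g).comp (map f)
  map_add : ∀ {M N : QRep Q k} (f g h : QRep.Hom M N),
    (∀ v x, h.app v x = f.app v x + g.app v x) →
    ∀ v x, (map h).app v x = (map f).app v x + (map g).app v x
  map_smul : ∀ {M N : QRep Q k} (c : k) (f g : QRep.Hom M N),
    (∀ v x, g.app v x = c • f.app v x) →
    ∀ v x, (map g).app v x = c • (map f).app v x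
  preserves_ses : ∀ {A B C : QRep Q k} (f : QRep.Hom A B) (g : QRep.Hom B C),
    IsSESpair f g → IsSESpair (map f) (map g)

/-- An extension of `U` by `V` (a short exact sequence `0 → V → B → U → 0`). -/
structure Extension {Q : FinQuiver} {k : Type} [Field k] (U V : QRep Q k) where
  B : QRep Q k
  i : QRep.Hom V B
  p : QRep.Hom B U
  ses : IsSESpair i p

/-- Equivalence of extensions (a morphism of short exact sequences fixing `U`
and `V`; by the five lemma it is automatically an isomorphism). -/
def extEquiv {Q : FinQuiver} {k : Type} [Field k] {U V : QRep Q k}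
    (e e' : Extension U V) : Prop :=
  ∃ φ : QRep.Hom e.B e'.B, φ.comp e.i = e'.i ∧ e'.p.comp φ = e.p

/-- `Ext¹_Q(U,V)` realized as equivalence classes of extensions. -/
def ExtYo {Q : FinQuiver} {k : Type} [Field k] (U V : QRep Q k) :=
  Quot (extEquiv (U := U) (V := V))

/-- The map `Ext¹_Q(U,V) → Ext¹_{Q'}(F U, F V)` induced by an exact functor. -/
noncomputable def extYoMap {Q Q' : FinQuiver} {k : Type} [Field k]
    (F : RepFunctor Q Q' k) (U V : QRep Q k) :
    ExtYo U V → ExtYo (F.obj U) (F.obj V) :=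
  Quot.map
    (fun e => ⟨F.obj e.B, F.map e.i, F.map e.p, F.preserves_ses e.i e.p e.ses⟩)
    (fun e e' h => by
      obtain ⟨φ, h1, h2⟩ := h
      exact ⟨F.map φ, by rw [← F.map_comp, h1], by rw [← F.map_comp, h2]⟩)


/-! ### Helper lemmas -/

namespace QRep

variable {Q : FinQuiver} {k : Type} [Field k]

theorem Hom.ext_app {M N : QRep Q k} {f g : Hom M N}
    (h : ∀ v x, f.app v x = g.app v x) : f = g := by
  obtain ⟨f, hf⟩ := f
  obtain ⟨g, hg⟩ := g
  have : f = g := funext fun v => LinearMap.ext (h v)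
  subst this
  rfl

theorem Iso.ext_app {M N : QRep Q k} {f g : Iso M N}
    (h : ∀ v x, f.app v x = g.app v x) : f = g := by
  obtain ⟨f, hf⟩ := f
  obtain ⟨g, hg⟩ := g
  have : f = g := funext fun v => LinearEquiv.ext (h v)
  subst this
  rfl

theorem SubRep.ext_sub {M : QRep Q k} {f g : SubRep M}
    (h : ∀ v, f.sub v = g.sub v) : f = g := by
  obtain ⟨f, hf⟩ := f
  obtain ⟨g, hg⟩ := g
  have : f = g := funext h
  subst this
  rfl

/-- The identity isomorphism. -/
def Iso.refl (M : QRep Q k) : Iso M M := ⟨fun _ => LinearEquiv.refl k _, fun _ _ => rfl⟩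

/-- The inverse isomorphism. -/
def Iso.symm {M N : QRep Q k} (f : Iso M N) : Iso N M :=
  ⟨fun v => (f.app v).symm, fun a x => by
    rw [LinearEquiv.symm_apply_eq, f.comm, LinearEquiv.apply_symm_apply]⟩

/-- Composition of isomorphisms. -/
def Iso.trans {M N P : QRep Q k} (f : Iso M N) (g : Iso N P) : Iso M P :=
  ⟨fun v => (f.app v).trans (g.app v), fun a x => by
    simp only [LinearEquiv.trans_apply, f.comm, g.comm]⟩

/-- The morphism underlying an isomorphism. -/
def Iso.toHom {M N : QRep Q k} (f : Iso M N) : Hom M N :=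
  ⟨fun v => (f.app v : M.space v →ₗ[k] N.space v), fun a x => f.comm a x⟩

@[simp] theorem Iso.toHom_app {M N : QRep Q k} (f : Iso M N) (v) (x : M.space v) :
    f.toHom.app v x = f.app v x := rfl
@[simp] theorem Iso.symm_app {M N : QRep Q k} (f : Iso M N) (v) (x : N.space v) :
    f.symm.app v x = (f.app v).symm x := rfl
@[simp] theorem Iso.trans_app {M N P : QRep Q k} (f : Iso M N) (g : Iso N P) (v)
    (x : M.space v) : (f.trans g).app v x = g.app v (f.app v x) := rfl
@[simp] theorem Hom.comp_app {M N P : QRep Q k} (f : Hom M N) (g : Hom N P) (v)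
    (x : M.space v) : (g.comp f).app v x = g.app v (f.app v x) := rfl
@[simp] theorem Hom.id_app {M : QRep Q k} (v)
    (x : M.space v) : (Hom.id M).app v x = x := rfl

/-- A vertexwise bijective morphism is an isomorphism. -/
noncomputable def Iso.ofBij {M N : QRep Q k} (f : Hom M N)
    (h : ∀ v, Function.Bijective (f.app v)) : Iso M N :=
  ⟨fun v => LinearEquiv.ofBijective (f.app v) (h v), fun a x => f.comm a x⟩

@[simp] theorem Iso.ofBij_app {M N : QRep Q k} (f : Hom M N)
    (h : ∀ v, Function.Bijective (f.app v)) (v) (x : M.space v) :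
    (Iso.ofBij f h).app v x = f.app v x := rfl

theorem IsIsomorphic.rfl' (M : QRep Q k) : IsIsomorphic M M := ⟨Iso.refl M⟩
theorem IsIsomorphic.symm' {M N : QRep Q k} (h : IsIsomorphic M N) : IsIsomorphic N M :=
  h.map Iso.symm
theorem IsIsomorphic.trans' {M N P : QRep Q k} (h : IsIsomorphic M N)
    (h' : IsIsomorphic N P) : IsIsomorphic M P := by
  obtain ⟨f⟩ := h
  obtain ⟨g⟩ := h'
  exact ⟨f.trans g⟩

/-- Postcomposition with an isomorphism. -/
def Iso.congrRight {M N P : QRep Q k} (g : Iso N P) : Iso M N ≃ Iso M P where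
  toFun f := f.trans g
  invFun f := f.trans g.symm
  left_inv f := Iso.ext_app fun v x => by simp
  right_inv f := Iso.ext_app fun v x => by simp

/-- Precomposition with an isomorphism. -/
def Iso.congrLeft {M N P : QRep Q k} (g : Iso M N) : Iso N P ≃ Iso M P where
  toFun f := g.trans f
  invFun f := g.symm.trans f
  left_inv f := Iso.ext_app fun v x => by simp
  right_inv f := Iso.ext_app fun v x => by simp

theorem card_iso_eq {M N : QRep Q k} (h : IsIsomorphic M N) :
    Nat.card (Iso M N) = autCard N := by
  obtain ⟨f⟩ := h
  exact Nat.card_congr f.congrLeft.symm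

theorem autCard_congr {M N : QRep Q k} (h : IsIsomorphic M N) :
    autCard M = autCard N := by
  rw [← card_iso_eq h]
  obtain ⟨f⟩ := h
  exact Nat.card_congr f.congrRight

section Fin
variable [Finite k]

instance space_finite (M : QRep Q k) (v : Q.V) : Finite (M.space v) :=
  Module.finite_of_finite k

instance lin_finite (X Y : Type) [AddCommGroup X] [Module k X] [Finite X]
    [AddCommGroup Y] [Module k Y] [Finite Y] : Finite (X →ₗ[k] Y) :=
  Finite.of_injective (fun f => (f : X → Y)) DFunLike.coe_injective

instance cochain_finite (U V : QRep Q k) : Finite (Cochain U V) := by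
  unfold Cochain; infer_instance

instance hom_finite (M N : QRep Q k) : Finite (Hom M N) :=
  Finite.of_injective (fun f => f.app) fun f g h =>
    Hom.ext_app fun v x => by
      have := congrFun h v
      simp only at this
      rw [this]

instance iso_finite (M N : QRep Q k) : Finite (Iso M N) :=
  Finite.of_injective (fun f => f.toHom) fun f g h =>
    Iso.ext_app fun v x => by
      have : f.toHom = g.toHom := h
      rw [← Iso.toHom_app, this, Iso.toHom_app]

instance subRep_finite (M : QRep Q k) : Finite (SubRep M) := by
  have : ∀ v, Finite (Submodule k (M.space v)) := fun v =>
    Finite.of_injective (fun L => (L : Set (M.space v))) SetLike.coe_injective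
  exact Finite.of_injective (fun L : SubRep M => L.sub) fun L L' h =>
    SubRep.ext_sub fun v => congrFun h v

theorem autCard_pos (M : QRep Q k) : 0 < autCard M := by
  have : Nonempty (Iso M M) := ⟨Iso.refl M⟩
  exact Nat.card_pos

end Fin

/-- Inclusion into the middle term. -/
def inlH {U V : QRep Q k} (z : Cochain U V) : Hom V (middle z) :=
  ⟨fun v => LinearMap.inl k (V.space v) (U.space v), fun a x => by
    refine Prod.ext ?_ ?_
    · change V.map a x = V.map a x + z a 0
      rw [map_zero, add_zero]
    · change 0 = U.map a 0
      rw [map_zero]⟩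

/-- Projection from the middle term. -/
def sndH {U V : QRep Q k} (z : Cochain U V) : Hom (middle z) U :=
  ⟨fun v => LinearMap.snd k (V.space v) (U.space v), fun a x => rfl⟩

theorem middle_ses {U V : QRep Q k} (z : Cochain U V) : IsSESpair (inlH z) (sndH z) :=
  fun _ => ⟨LinearMap.inl_injective, LinearMap.snd_surjective, LinearMap.range_inl k _ _⟩

/-- The shear isomorphism. -/
def shear {U V : QRep Q k} (z : Cochain U V) (f : ∀ v, U.space v →ₗ[k] V.space v) :
    Iso (middle (z + coboundary f)) (middle z) where
  app v :=
    { toFun := fun x => ((x.1 + f v x.2, x.2) : V.space v × U.space v)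
      invFun := fun x => ((x.1 - f v x.2, x.2) : V.space v × U.space v)
      map_add' := fun x y => by
        refine Prod.ext ?_ rfl
        change x.1 + y.1 + f v (x.2 + y.2) = x.1 + f v x.2 + (y.1 + f v y.2)
        rw [map_add]; abel
      map_smul' := fun c x => by
        refine Prod.ext ?_ rfl
        change c • x.1 + f v (c • x.2) = c • (x.1 + f v x.2)
        rw [map_smul, smul_add]
      left_inv := fun x => Prod.ext (add_sub_cancel_right _ _) rfl
      right_inv := fun x => Prod.ext (sub_add_cancel _ _) rfl }
  comm a x := by
    refine Prod.ext ?_ rfl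
    change V.map a x.1 + (z a x.2 + (V.map a (f _ x.2) - f _ (U.map a x.2)))
        + f _ (U.map a x.2) = V.map a (x.1 + f _ x.2) + z a x.2
    rw [map_add]; abel

theorem shear_app {U V : QRep Q k} (z : Cochain U V) (f : ∀ v, U.space v →ₗ[k] V.space v)
    (v) (x : V.space v × U.space v) :
    (shear z f).app v x = ((x.1 + f v x.2, x.2) : V.space v × U.space v) := rfl

theorem exists_shear {U V : QRep Q k} (z z' : Cochain U V)
    (ψ : Hom (middle z') (middle z)) (h1 : ψ.comp (inlH z') = inlH z)
    (h2 : (sndH z).comp ψ = sndH z') :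
    ∃ f : ∀ v, U.space v →ₗ[k] V.space v, z' = z + coboundary f ∧
      ∀ (v) (x : V.space v × U.space v),
        ψ.app v x = ((x.1 + f v x.2, x.2) : V.space v × U.space v) := by
  let f : ∀ v, U.space v →ₗ[k] V.space v := fun v =>
    (LinearMap.fst k (V.space v) (U.space v)).comp
      ((ψ.app v).comp (LinearMap.inr k (V.space v) (U.space v)))
  have h1' : ∀ v (x : V.space v), ψ.app v ((x, 0) : V.space v × U.space v)
      = ((x, 0) : V.space v × U.space v) := fun v x => by
    have := congrArg (fun g : Hom V (middle z) => g.app v x) h1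
    exact this
  have h2' : ∀ v (x : V.space v × U.space v), (ψ.app v x).2 = x.2 := fun v x => by
    have := congrArg (fun g : Hom (middle z') U => g.app v x) h2
    exact this
  have hψ : ∀ (v) (x : V.space v × U.space v),
        ψ.app v x = ((x.1 + f v x.2, x.2) : V.space v × U.space v) := fun v x => by
    refine Prod.ext ?_ (h2' v x)
    have hx : x = ((x.1, 0) + (0, x.2) : V.space v × U.space v) := by simp
    have h3 : ψ.app v x = (ψ.app v ((x.1, 0) : V.space v × U.space v) +
        ψ.app v ((0, x.2) : V.space v × U.space v)) := by
      exact (congrArg (ψ.app v) hx).trans ((ψ.app v).map_add _ _)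
    rw [h3, h1']
    rfl
  refine ⟨f, ?_, hψ⟩
  funext a
  ext u
  have h4 := ψ.comm a ((0, u) : V.space _ × U.space _)
  have h5 : (middle z').map a ((0, u) : V.space _ × U.space _) =
      ((z' a u, U.map a u) : V.space _ × U.space _) := by
    refine Prod.ext ?_ rfl
    change V.map a 0 + z' a u = z' a u
    rw [map_zero, zero_add]
  rw [h5, hψ, hψ] at h4
  have h6 := congrArg Prod.fst h4
  change z' a u + f _ (U.map a u) = V.map a (0 + f _ u) + z a u at h6
  change z' a u = z a u + (V.map a (f _ u) - f _ (U.map a u))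
  rw [zero_add] at h6
  rw [eq_sub_of_add_eq h6]; abel

theorem exists_split {U V W : QRep Q k} (i : Hom V W) (p : Hom W U) (h : IsSESpair i p) :
    ∃ (z : Cochain U V) (φ : Iso (middle z) W),
      φ.toHom.comp (inlH z) = i ∧ (sndH z).comp φ.symm.toHom = p := by
  have hs : ∀ v, ∃ s : U.space v →ₗ[k] W.space v, (p.app v).comp s = LinearMap.id := fun v =>
    (p.app v).exists_rightInverse_of_surjective (LinearMap.range_eq_top.2 (h v).2.1)
  choose s hs using hs
  have hs' : ∀ v u, p.app v (s v u) = u := fun v u => congrArg (fun g => g u) (hs v)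
  have hpi : ∀ v x, p.app v (i.app v x) = 0 := fun v x => by
    have : i.app v x ∈ LinearMap.range (i.app v) := ⟨x, rfl⟩
    rw [(h v).2.2] at this
    exact this
  let g : ∀ v, V.space v × U.space v →ₗ[k] W.space v := fun v =>
    (i.app v).coprod (s v)
  have hg : ∀ v x, g v x = i.app v x.1 + s v x.2 := fun v x => rfl
  have hpg : ∀ v x, p.app v (g v x) = x.2 := fun v x => by
    rw [hg, map_add, hpi, hs', zero_add]
  have hgb : ∀ v, Function.Bijective (g v) := by
    intro v
    constructor
    · rw [injective_iff_map_eq_zero]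
      intro x hx
      have h2 : x.2 = 0 := by rw [← hpg v x, hx, map_zero]
      rw [hg, h2, map_zero, add_zero] at hx
      exact Prod.ext ((h v).1 (by simpa using hx)) h2
    · intro w
      have : w - s v (p.app v w) ∈ LinearMap.range (i.app v) := by
        rw [(h v).2.2, LinearMap.mem_ker, map_sub, hs', sub_self]
      obtain ⟨y, hy⟩ := this
      exact ⟨(y, p.app v w), by rw [hg, hy]; simp⟩
  let e : ∀ v, (V.space v × U.space v) ≃ₗ[k] W.space v := fun v =>
    LinearEquiv.ofBijective (g v) (hgb v)
  have he : ∀ v x, e v x = i.app v x.1 + s v x.2 := fun v x => rfl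
  have he2 : ∀ v w, ((e v).symm w).2 = p.app v w := fun v w => by
    rw [← hpg v ((e v).symm w)]
    exact congrArg (p.app v) ((e v).apply_symm_apply w)
  let z : Cochain U V := fun a =>
    (LinearMap.fst k (V.space _) (U.space _)).comp ((e (Q.tgt a)).symm.toLinearMap.comp
      ((W.map a).comp (s (Q.src a))))
  have hz : ∀ a u, i.app _ (z a u) + s _ (U.map a u) = W.map a (s _ u) := fun a u => by
    have h1 := (e (Q.tgt a)).apply_symm_apply (W.map a (s _ u))
    rw [he, he2, p.comm, hs'] at h1
    exact h1
  let φ : Iso (middle z) W := ⟨e, fun a x => by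
    change i.app _ (V.map a x.1 + z a x.2) + s _ (U.map a x.2) =
      W.map a (i.app _ x.1 + s _ x.2)
    rw [map_add, map_add, add_assoc, hz, i.comm]⟩
  refine ⟨z, φ, ?_, ?_⟩
  · refine Hom.ext_app fun v x => ?_
    change i.app v x + s v 0 = i.app v x
    rw [map_zero, add_zero]
  · exact Hom.ext_app fun v x => he2 v x

end QRep

theorem card_fiber {α β : Type*} [Finite α] [Finite β] (f : α → β) (m : ℕ) (P : β → Prop)
    (h : ∀ b, P b → Nat.card {a // f a = b} = m) :
    Nat.card {a // P (f a)} = m * Nat.card {b // P b} := by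
  let e : {a // P (f a)} ≃ Σ b : {b // P b}, {a // f a = b.1} :=
    { toFun := fun a => ⟨⟨f a.1, a.2⟩, ⟨a.1, rfl⟩⟩
      invFun := fun x => ⟨x.2.1, by rw [x.2.2]; exact x.1.2⟩
      left_inv := fun a => rfl
      right_inv := by
        rintro ⟨⟨b, hb⟩, ⟨a, h⟩⟩
        have h' : f a = b := h
        subst h'
        rfl }
  have := Fintype.ofFinite {b // P b}
  rw [Nat.card_congr e, Nat.card_sigma, Finset.sum_congr rfl (fun b _ => h b.1 b.2)]
  simp [mul_comm, Nat.card_eq_fintype_card]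

theorem card_fiber_all {α β : Type*} [Finite α] [Finite β] (f : α → β) (m : ℕ)
    (h : ∀ b, Nat.card {a // f a = b} = m) :
    Nat.card α = m * Nat.card β := by
  have h1 := card_fiber f m (fun _ => True) (fun b _ => h b)
  rwa [Nat.card_congr (Equiv.subtypeUnivEquiv (fun _ => trivial)),
    Nat.card_congr (Equiv.subtypeUnivEquiv (fun _ => trivial))] at h1

section Count

variable {Q : FinQuiver} {k : Type} [Field k] [Finite k]

/-- Short exact sequences `0 → V → W → U → 0` with given terms. -/
abbrev SESset (U V W : QRep Q k) :=
  {ip : QRep.Hom V W × QRep.Hom W U // IsSESpair ip.1 ip.2}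

/-- Degree zero cochains. -/
abbrev C0 (U V : QRep Q k) := ∀ v, U.space v →ₗ[k] V.space v

theorem transport_ses {U V W : QRep Q k} (z : Cochain U V) (φ : Iso (middle z) W) :
    IsSESpair (φ.toHom.comp (inlH z)) ((sndH z).comp φ.symm.toHom) := by
  intro v
  refine ⟨(φ.app v).injective.comp (middle_ses z v).1,
    (middle_ses z v).2.1.comp (φ.app v).symm.surjective, ?_⟩
  have h := (middle_ses z v).2.2
  ext w
  constructor
  · rintro ⟨x, rfl⟩
    have : (inlH z).app v x ∈ LinearMap.ker ((sndH z).app v) := by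
      rw [← h]; exact ⟨x, rfl⟩
    rw [LinearMap.mem_ker] at this ⊢
    simpa using this
  · intro hw
    have : (φ.app v).symm w ∈ LinearMap.range ((inlH z).app v) := by
      rw [h]; exact hw
    obtain ⟨x, hx⟩ := this
    refine ⟨x, ?_⟩
    simp [hx]

/-- A cochain with a trivialisation of its middle term gives a short exact sequence. -/
def toSES {U V W : QRep Q k} (t : Σ z : Cochain U V, Iso (middle z) W) : SESset U V W :=
  ⟨(t.2.toHom.comp (inlH t.1), (sndH t.1).comp t.2.symm.toHom), transport_ses t.1 t.2⟩

theorem toSES_fiber {U V W : QRep Q k} (e : SESset U V W) :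
    Nat.card {t : Σ z : Cochain U V, Iso (middle z) W // toSES t = e} = Nat.card (C0 U V) := by
  obtain ⟨⟨i, p⟩, h⟩ := e
  obtain ⟨z, φ, rfl, rfl⟩ := exists_split i p h
  symm
  let F : C0 U V → {t : Σ z : Cochain U V, Iso (middle z) W // toSES t =
      ⟨(φ.toHom.comp (inlH z), (sndH z).comp φ.symm.toHom), h⟩} := fun f =>
    ⟨⟨z + coboundary f, (shear z f).trans φ⟩, by
      refine Subtype.ext (Prod.ext ?_ ?_)
      · refine Hom.ext_app fun v x => ?_
        change φ.app v ((x + f v 0, 0) : V.space v × U.space v) =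
          φ.app v ((x, 0) : V.space v × U.space v)
        rw [map_zero, add_zero]
      · exact Hom.ext_app fun v x => rfl⟩
  refine Nat.card_congr (Equiv.ofBijective F ⟨?_, ?_⟩)
  · intro f g hfg
    have h1 : (F f).1 = (F g).1 := congrArg Subtype.val hfg
    have h2 : ∀ (t t' : Σ z : Cochain U V, Iso (middle z) W), t = t' →
        ∀ v (x : V.space v × U.space v), t.2.app v x = t'.2.app v x := by
      rintro t _ rfl v x; rfl
    funext v
    ext u
    have h3 := (φ.app v).injective (h2 _ _ h1 v (0, u))
    have h4 : (0 : V.space v) + f v u = 0 + g v u := congrArg Prod.fst h3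
    simpa using h4
  · rintro ⟨⟨z', φ'⟩, ht⟩
    have ht' := congrArg Subtype.val ht
    have h1 : φ'.toHom.comp (inlH z') = φ.toHom.comp (inlH z) := congrArg Prod.fst ht'
    have h2 : (sndH z').comp φ'.symm.toHom = (sndH z).comp φ.symm.toHom :=
      congrArg Prod.snd ht'
    obtain ⟨f, rfl, hf⟩ := exists_shear z z' (φ'.trans φ.symm).toHom
      (Hom.ext_app fun v x => by
        have := congrArg (fun g : Hom V W => g.app v x) h1
        simp only [Hom.comp_app, Iso.toHom_app, Iso.trans_app, Iso.symm_app] at this ⊢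
        rw [this, LinearEquiv.symm_apply_apply])
      (Hom.ext_app fun v x => by
        have := congrArg (fun g : Hom W U => g.app v (φ'.app v x)) h2
        simp only [Hom.comp_app, Iso.toHom_app, Iso.trans_app, Iso.symm_app] at this ⊢
        rw [← this, LinearEquiv.symm_apply_apply])
    refine ⟨f, Subtype.ext ?_⟩
    change (⟨z + coboundary f, (shear z f).trans φ⟩ : Σ z : Cochain U V, Iso (middle z) W) =
      ⟨z + coboundary f, φ'⟩
    congr 1
    refine Iso.ext_app fun v x => ?_
    have h3 : (shear z f).app v x = (φ.app v).symm (φ'.app v x) := (hf v x).symm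
    rw [Iso.trans_app, h3, LinearEquiv.apply_symm_apply]

theorem card_middle (U V W : QRep Q k) :
    Nat.card {z : Cochain U V // IsIsomorphic (middle z) W} * autCard W =
      Nat.card (C0 U V) * Nat.card (SESset U V W) := by
  rw [← card_fiber_all (toSES (U := U) (V := V) (W := W)) _ toSES_fiber]
  have h := card_fiber (fun t : Σ z : Cochain U V, Iso (middle z) W => t.1) (autCard W)
    (fun z => IsIsomorphic (middle z) W) (fun z hz => by
      rw [← card_iso_eq hz]
      exact Nat.card_congr
        { toFun := fun t => t.2 ▸ t.1.2
          invFun := fun f => ⟨⟨z, f⟩, rfl⟩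
          left_inv := by rintro ⟨⟨z, f⟩, rfl⟩; rfl
          right_inv := fun f => rfl })
  rw [mul_comm, ← h]
  exact Nat.card_congr (Equiv.subtypeUnivEquiv fun t => ⟨t.2⟩)

/-- The image of a morphism. -/
def imSub {V W : QRep Q k} (i : QRep.Hom V W) : SubRep W :=
  ⟨fun v => LinearMap.range (i.app v), by
    rintro a _ ⟨x, rfl⟩
    exact ⟨V.map a x, i.comm a x⟩⟩

/-- The inclusion of a subrepresentation. -/
def inclH {W : QRep Q k} (L : SubRep W) : QRep.Hom L.toRep W :=
  ⟨fun v => (L.sub v).subtype, fun _ _ => rfl⟩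

/-- The projection to the quotient representation. -/
def mkH {W : QRep Q k} (L : SubRep W) : QRep.Hom W L.quotRep :=
  ⟨fun v => (L.sub v).mkQ, fun _ _ => rfl⟩

theorem exists_isoSub {V W : QRep Q k} (i : QRep.Hom V W) (L : SubRep W)
    (hi : ∀ v, Function.Injective (i.app v)) (hL : ∀ v, LinearMap.range (i.app v) = L.sub v) :
    ∃ f : Iso V L.toRep, (inclH L).comp f.toHom = i := by
  have hm : ∀ v x, i.app v x ∈ L.sub v := fun v x => by rw [← hL]; exact ⟨x, rfl⟩
  let g : QRep.Hom V L.toRep := ⟨fun v => (i.app v).codRestrict (L.sub v) (hm v),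
    fun a x => Subtype.ext (i.comm a x)⟩
  refine ⟨Iso.ofBij g fun v => ⟨fun x y hxy => hi v (congrArg Subtype.val hxy), ?_⟩, ?_⟩
  · rintro ⟨w, hw⟩
    rw [← hL] at hw
    obtain ⟨x, rfl⟩ := hw
    exact ⟨x, rfl⟩
  · exact Hom.ext_app fun v x => rfl

theorem exists_isoQuot {U W : QRep Q k} (p : QRep.Hom W U) (L : SubRep W)
    (hp : ∀ v, Function.Surjective (p.app v)) (hL : ∀ v, LinearMap.ker (p.app v) = L.sub v) :
    ∃ f : Iso L.quotRep U, f.toHom.comp (mkH L) = p := by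
  let g : QRep.Hom L.quotRep U := ⟨fun v => (L.sub v).liftQ (p.app v) (hL v).ge,
    fun a x => by
      obtain ⟨x, rfl⟩ := (L.sub _).mkQ_surjective x
      exact p.comm a x⟩
  refine ⟨Iso.ofBij g fun v => ⟨?_, ?_⟩, ?_⟩
  · rw [← LinearMap.ker_eq_bot]
    exact Submodule.ker_liftQ_eq_bot _ _ _ (hL v).le
  · intro u
    obtain ⟨w, rfl⟩ := hp v u
    exact ⟨(L.sub v).mkQ w, rfl⟩
  · exact Hom.ext_app fun v x => rfl

theorem sub_ses {U V W : QRep Q k} (L : SubRep W) (α : Iso V L.toRep) (β : Iso L.quotRep U) :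
    IsSESpair ((inclH L).comp α.toHom) (β.toHom.comp (mkH L)) := by
  intro v
  refine ⟨Subtype.val_injective.comp (α.app v).injective,
    (β.app v).surjective.comp (L.sub v).mkQ_surjective, ?_⟩
  ext w
  constructor
  · rintro ⟨x, rfl⟩
    change β.app v ((L.sub v).mkQ (α.app v x).1) = 0
    exact (LinearEquiv.map_eq_zero_iff (β.app v)).2
      ((Submodule.Quotient.mk_eq_zero _).2 (α.app v x).2)
  · intro hw
    have h1 : β.app v ((L.sub v).mkQ w) = 0 := hw
    have h2 : w ∈ L.sub v := (Submodule.Quotient.mk_eq_zero _).1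
      ((LinearEquiv.map_eq_zero_iff (β.app v)).1 h1)
    refine ⟨(α.app v).symm ⟨w, h2⟩, ?_⟩
    exact congrArg Subtype.val ((α.app v).apply_symm_apply ⟨w, h2⟩)

theorem sub_im {V W : QRep Q k} (L : SubRep W) (α : Iso V L.toRep) :
    imSub ((inclH L).comp α.toHom) = L := by
  refine SubRep.ext_sub fun v => ?_
  ext w
  constructor
  · rintro ⟨x, rfl⟩
    exact (α.app v x).2
  · intro hw
    refine ⟨(α.app v).symm ⟨w, hw⟩, ?_⟩
    exact congrArg Subtype.val ((α.app v).apply_symm_apply ⟨w, hw⟩)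

theorem card_ses_fiber (U V W : QRep Q k) (L : SubRep W) :
    Nat.card {e : SESset U V W // imSub e.1.1 = L} =
      Nat.card (Iso V L.toRep × Iso L.quotRep U) := by
  symm
  refine Nat.card_congr (Equiv.ofBijective (fun ab =>
    ⟨⟨((inclH L).comp ab.1.toHom, ab.2.toHom.comp (mkH L)), sub_ses L ab.1 ab.2⟩,
      sub_im L ab.1⟩) ⟨?_, ?_⟩)
  · rintro ⟨α, β⟩ ⟨α', β'⟩ h
    have h0 := congrArg (fun t => t.1.1) h
    have h1 : (inclH L).comp α.toHom = (inclH L).comp α'.toHom := congrArg Prod.fst h0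
    have h2 : β.toHom.comp (mkH L) = β'.toHom.comp (mkH L) := congrArg Prod.snd h0
    refine Prod.ext (Iso.ext_app fun v x => ?_) (Iso.ext_app fun v x => ?_)
    · exact Subtype.ext (congrArg (fun g : Hom V W => g.app v x) h1)
    · obtain ⟨x, rfl⟩ := (L.sub v).mkQ_surjective x
      exact congrArg (fun g : Hom W U => g.app v x) h2
  · rintro ⟨⟨⟨i, p⟩, h⟩, rfl⟩
    obtain ⟨α, hα⟩ := exists_isoSub i (imSub i) (fun v => (h v).1) (fun v => rfl)
    obtain ⟨β, hβ⟩ := exists_isoQuot p (imSub i) (fun v => (h v).2.1)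
      (fun v => (h v).2.2.symm)
    exact ⟨(α, β), Subtype.ext (Subtype.ext (Prod.ext hα hβ))⟩

theorem card_ses (U V W : QRep Q k) :
    Nat.card (SESset U V W) = (autCard U * autCard V) * hallNum U V W := by
  have h := card_fiber (fun e : SESset U V W => imSub e.1.1) (autCard U * autCard V)
    (fun L => IsIsomorphic L.toRep V ∧ IsIsomorphic L.quotRep U) (fun L hL => by
      rw [card_ses_fiber, Nat.card_prod, card_iso_eq hL.1.symm', card_iso_eq hL.2,
        autCard_congr hL.1, mul_comm])
  rw [hallNum, ← h]
  refine (Nat.card_congr (Equiv.subtypeUnivEquiv fun e => ?_)).symm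
  obtain ⟨⟨i, p⟩, h⟩ := e
  obtain ⟨α, hα⟩ := exists_isoSub i (imSub i) (fun v => (h v).1) (fun v => rfl)
  obtain ⟨β, hβ⟩ := exists_isoQuot p (imSub i) (fun v => (h v).2.1)
    (fun v => (h v).2.2.symm)
  exact ⟨⟨α.symm⟩, ⟨β⟩⟩

end Count

section ExtCount

variable {Q : FinQuiver} {k : Type} [Field k]

theorem extEquiv_bij {U V : QRep Q k} (e e' : Extension U V) (φ : QRep.Hom e.B e'.B)
    (h1 : φ.comp e.i = e'.i) (h2 : e'.p.comp φ = e.p) (v) :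
    Function.Bijective (φ.app v) := by
  have h1' : ∀ x, φ.app v (e.i.app v x) = e'.i.app v x := fun x =>
    congrArg (fun g : QRep.Hom V e'.B => g.app v x) h1
  have h2' : ∀ x, e'.p.app v (φ.app v x) = e.p.app v x := fun x =>
    congrArg (fun g : QRep.Hom e.B U => g.app v x) h2
  constructor
  · rw [injective_iff_map_eq_zero]
    intro x hx
    have h3 : x ∈ LinearMap.ker (e.p.app v) := by
      rw [LinearMap.mem_ker, ← h2', hx, map_zero]
    rw [← (e.ses v).2.2] at h3
    obtain ⟨y, rfl⟩ := h3
    rw [h1'] at hx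
    have : y = 0 := (e'.ses v).1 (by rw [hx, map_zero])
    rw [this, map_zero]
  · intro w
    obtain ⟨x, hx⟩ := (e.ses v).2.1 (e'.p.app v w)
    have h3 : w - φ.app v x ∈ LinearMap.ker (e'.p.app v) := by
      rw [LinearMap.mem_ker, map_sub, h2', hx, sub_self]
    rw [← (e'.ses v).2.2] at h3
    obtain ⟨y, hy⟩ := h3
    refine ⟨x + e.i.app v y, ?_⟩
    rw [map_add, h1', hy]; abel

theorem extEquiv_equivalence (U V : QRep Q k) :
    Equivalence (extEquiv (U := U) (V := V)) where
  refl e := ⟨Hom.id _, Hom.ext_app fun _ _ => rfl, Hom.ext_app fun _ _ => rfl⟩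
  symm := by
    rintro e e' ⟨φ, h1, h2⟩
    let ψ := Iso.ofBij φ (extEquiv_bij e e' φ h1 h2)
    refine ⟨ψ.symm.toHom, ?_, ?_⟩
    · rw [← h1]
      exact Hom.ext_app fun v x => (ψ.app v).symm_apply_apply _
    · rw [← h2]
      exact Hom.ext_app fun v x => congrArg (e'.p.app v) ((ψ.app v).apply_symm_apply x)
  trans := by
    rintro e e' e'' ⟨φ, h1, h2⟩ ⟨ψ, h3, h4⟩
    refine ⟨ψ.comp φ, ?_, ?_⟩
    · rw [← h3, ← h1]; rfl
    · rw [← h2, ← h4]; rfl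

theorem extYo_eq {U V : QRep Q k} (e e' : Extension U V) :
    ((Quot.mk _ e : ExtYo U V) = Quot.mk _ e') ↔ extEquiv e e' :=
  (extEquiv_equivalence U V).quot_mk_eq_iff e e'

/-- The extension attached to a cochain. -/
def midExt {U V : QRep Q k} (z : Cochain U V) : Extension U V :=
  ⟨middle z, inlH z, sndH z, middle_ses z⟩

/-- The class of the extension attached to a cochain. -/
def midCls {U V : QRep Q k} (z : Cochain U V) : ExtYo U V := Quot.mk _ (midExt z)

theorem midCls_surj (U V : QRep Q k) : Function.Surjective (midCls (U := U) (V := V)) := by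
  rintro ⟨e⟩
  obtain ⟨z, φ, h1, h2⟩ := exists_split e.i e.p e.ses
  refine ⟨z, (extYo_eq _ _).2 ⟨φ.toHom, h1, ?_⟩⟩
  rw [← h2]
  exact Hom.ext_app fun v x =>
    congrArg ((sndH z).app v) ((φ.app v).symm_apply_apply x)

theorem midCls_eq {U V : QRep Q k} (z' z : Cochain U V) :
    midCls z' = midCls z ↔ ∃ f, z' = z + coboundary f := by
  refine (extYo_eq _ _).trans ?_
  constructor
  · rintro ⟨φ, h1, h2⟩
    obtain ⟨f, hf, -⟩ := exists_shear z z' φ h1 h2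
    exact ⟨f, hf⟩
  · rintro ⟨f, rfl⟩
    refine ⟨(shear z f).toHom, ?_, ?_⟩
    · refine Hom.ext_app fun v x => ?_
      change ((x + f v 0, 0) : V.space v × U.space v) = (x, 0)
      rw [map_zero, add_zero]
    · exact Hom.ext_app fun v x => rfl

instance extYo_finite [Finite k] (U V : QRep Q k) : Finite (ExtYo U V) :=
  Finite.of_surjective _ (midCls_surj U V)

theorem midCls_fiber (U V : QRep Q k) (c : ExtYo U V) :
    Nat.card {z : Cochain U V // midCls z = c} =
      Nat.card {z : Cochain U V // ∃ f, z = coboundary f} := by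
  obtain ⟨z, rfl⟩ := midCls_surj U V c
  symm
  refine Nat.card_congr ((Equiv.addLeft z).subtypeEquiv fun y => ?_)
  rw [midCls_eq]
  simp

/-- The middle term of a class of extensions is isomorphic to `W`. -/
def HasMid {U V : QRep Q k} (W : QRep Q k) (c : ExtYo U V) : Prop :=
  ∃ e : Extension U V, Quot.mk _ e = c ∧ IsIsomorphic e.B W

theorem hasMid_mk {U V W : QRep Q k} (e : Extension U V) :
    HasMid W (Quot.mk _ e : ExtYo U V) ↔ IsIsomorphic e.B W := by
  constructor
  · rintro ⟨e', h, h'⟩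
    obtain ⟨φ, h1, h2⟩ := (extYo_eq _ _).1 h
    exact IsIsomorphic.trans' (IsIsomorphic.symm' ⟨Iso.ofBij φ (extEquiv_bij e' e φ h1 h2)⟩) h'
  · intro h
    exact ⟨e, rfl, h⟩

theorem natCard_lin (X Y : Type) [AddCommGroup X] [Module k X] [FiniteDimensional k X]
    [AddCommGroup Y] [Module k Y] [FiniteDimensional k Y] :
    Nat.card (X →ₗ[k] Y) = Nat.card k ^ (Module.finrank k X * Module.finrank k Y) := by
  rw [Module.natCard_eq_pow_finrank (K := k), Module.finrank_linearMap]

theorem euler_eq [Fintype k] (U V : QRep Q k) :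
    (Fintype.card k : ℚ) ^ eulerFormN Q U.dimVec V.dimVec =
      (Nat.card (C0 U V) : ℚ) / (Nat.card (Cochain U V) : ℚ) := by
  have hq : (Fintype.card k : ℚ) ≠ 0 := by
    exact_mod_cast Fintype.card_ne_zero
  have h1 : Nat.card (C0 U V) = Fintype.card k ^ (∑ v, U.dimVec v * V.dimVec v) := by
    unfold C0
    rw [Nat.card_pi]
    simp only [natCard_lin, Finset.prod_pow_eq_pow_sum, Nat.card_eq_fintype_card]
    rfl
  have h2 : Nat.card (Cochain U V) =
      Fintype.card k ^ (∑ a, U.dimVec (Q.src a) * V.dimVec (Q.tgt a)) := by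
    unfold Cochain
    rw [Nat.card_pi]
    simp only [natCard_lin, Finset.prod_pow_eq_pow_sum, Nat.card_eq_fintype_card]
    rfl
  rw [h1, h2, eulerFormN, eulerForm, zpow_sub₀ hq]
  push_cast
  rw [← zpow_natCast, ← zpow_natCast]
  push_cast
  rfl

/-- Normalised Riedtmann formula. -/
theorem riedtmann [Fintype k] (U V W : QRep Q k) :
    (Fintype.card k : ℚ) ^ eulerFormN Q U.dimVec V.dimVec * (hallNum U V W : ℚ) *
      ((autCard U : ℚ) * autCard V) =
      (Nat.card {z : Cochain U V // IsIsomorphic (middle z) W} : ℚ) * autCard W /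
        (Nat.card (Cochain U V) : ℚ) := by
  rw [euler_eq]
  have h := card_middle U V W
  rw [card_ses] at h
  have h' : (Nat.card {z : Cochain U V // IsIsomorphic (middle z) W} : ℚ) * autCard W =
    Nat.card (C0 U V) * ((autCard U * autCard V) * hallNum U V W) := by exact_mod_cast h
  rw [h']
  ring

theorem isoRel_equivalence (α : Q.V → ℕ) : Equivalence (isoRel Q k α) where
  refl W := IsIsomorphic.rfl' _
  symm := fun h => IsIsomorphic.symm' h
  trans := fun h h' => IsIsomorphic.trans' h h'

theorem exists_cls (M : QRep Q k) : ∃ c : TotalClass Q k, IsIsomorphic M c.rep := by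
  let e : ∀ v, M.space v ≃ₗ[k] (Fin (M.dimVec v) → k) := fun v =>
    (Module.finBasis k (M.space v)).equivFun
  let W : StdRep Q k M.dimVec := fun a =>
    LinearMap.toMatrix' ((e (Q.tgt a)).toLinearMap.comp
      ((M.map a).comp (e (Q.src a)).symm.toLinearMap))
  refine ⟨⟨M.dimVec, Quot.mk _ W⟩, IsIsomorphic.trans' (N := W.toQRep) ⟨⟨e, fun a x => ?_⟩⟩ ?_⟩
  · change e _ (M.map a x) = Matrix.mulVecLin (W a) (e _ x)
    have : Matrix.mulVecLin (W a) = ((e (Q.tgt a)).toLinearMap.comp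
      ((M.map a).comp (e (Q.src a)).symm.toLinearMap)) := by
      exact Matrix.toLin'_toMatrix' _
    rw [this]
    simp
  · have h : Quot.mk (isoRel Q k M.dimVec) W =
        Quot.mk _ (Quot.out (Quot.mk (isoRel Q k M.dimVec) W)) := (Quot.out_eq _).symm
    exact ((isoRel_equivalence _).quot_mk_eq_iff _ _).1 h

theorem rep_inj {c c' : TotalClass Q k} (h : IsIsomorphic c.rep c'.rep) : c = c' := by
  obtain ⟨α, c⟩ := c
  obtain ⟨β, c'⟩ := c'
  have hαβ : α = β := by
    obtain ⟨f⟩ := h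
    funext v
    have h1 : Module.finrank k (Fin (α v) → k) = Module.finrank k (Fin (β v) → k) :=
      LinearEquiv.finrank_eq (f.app v)
    simpa using h1
  subst hαβ
  congr 1
  rw [← Quot.out_eq c, ← Quot.out_eq c']
  exact Quot.sound h

end ExtCount

theorem F_iso {Q Q' : FinQuiver} {k : Type} [Field k] (F : RepFunctor Q Q' k)
    {M N : QRep Q k} (h : IsIsomorphic M N) : IsIsomorphic (F.obj M) (F.obj N) := by
  obtain ⟨f⟩ := h
  have h1 : (F.map f.symm.toHom).comp (F.map f.toHom) = Hom.id _ := by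
    rw [← F.map_comp, ← F.map_id]
    congr 1
    exact Hom.ext_app fun v x => (f.app v).symm_apply_apply x
  have h2 : (F.map f.toHom).comp (F.map f.symm.toHom) = Hom.id _ := by
    rw [← F.map_comp, ← F.map_id]
    congr 1
    exact Hom.ext_app fun v x => (f.app v).apply_symm_apply x
  refine ⟨Iso.ofBij (F.map f.toHom) fun v => Function.bijective_iff_has_inverse.2
    ⟨(F.map f.symm.toHom).app v, fun x => ?_, fun x => ?_⟩⟩
  · exact congrArg (fun g : Hom (F.obj M) (F.obj M) => g.app v x) h1
  · exact congrArg (fun g : Hom (F.obj N) (F.obj N) => g.app v x) h2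

/-- The proportion of cochains with prescribed middle term is preserved. -/
theorem proportion {Q Q' : FinQuiver} {k : Type} [Field k] [Fintype k]
    (F : RepFunctor Q Q' k)
    (hfib : ∀ (U V : QRep Q k) (c c' : ExtYo (F.obj U) (F.obj V)),
      Nat.card {e : ExtYo U V // extYoMap F U V e = c} =
        Nat.card {e : ExtYo U V // extYoMap F U V e = c'}) (U V : QRep Q k) (W : QRep Q' k) :
    (Nat.card {z : Cochain U V // IsIsomorphic (F.obj (middle z)) W} : ℚ) /
        (Nat.card (Cochain U V) : ℚ) =
      (Nat.card {z : Cochain (F.obj U) (F.obj V) // IsIsomorphic (middle z) W} : ℚ) /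
        (Nat.card (Cochain (F.obj U) (F.obj V)) : ℚ) := by
  set N := Nat.card {z : Cochain U V // ∃ f, z = coboundary f}
  set N' := Nat.card {z : Cochain (F.obj U) (F.obj V) // ∃ f, z = coboundary f}
  set h := Nat.card {e : ExtYo U V // extYoMap F U V e = midCls 0}
  have hf : ∀ c, Nat.card {z : Cochain U V // extYoMap F U V (midCls z) = c} = N * h := by
    intro c
    rw [card_fiber midCls N (fun e => extYoMap F U V e = c) (fun b _ => midCls_fiber U V b),
      hfib U V c (midCls 0)]
  have e1 := card_fiber_all _ _ hf
  have e2 := card_fiber _ _ (HasMid W) (fun c _ => hf c)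
  have e3 := card_fiber_all _ _ (midCls_fiber (F.obj U) (F.obj V))
  have e4 := card_fiber _ _ (HasMid W) (fun c _ => midCls_fiber (F.obj U) (F.obj V) c)
  have e5 : ∀ z : Cochain U V, HasMid W (extYoMap F U V (midCls z)) ↔
      IsIsomorphic (F.obj (middle z)) W := fun z => hasMid_mk _
  have e6 : ∀ z : Cochain (F.obj U) (F.obj V), HasMid W (midCls z) ↔
      IsIsomorphic (middle z) W := fun z => hasMid_mk _
  rw [Nat.card_congr (Equiv.subtypeEquivRight e5)] at e2
  rw [Nat.card_congr (Equiv.subtypeEquivRight e6)] at e4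
  have p1 : 0 < Nat.card (Cochain U V) := Nat.card_pos
  have p2 : 0 < Nat.card (Cochain (F.obj U) (F.obj V)) := Nat.card_pos
  rw [div_eq_div_iff (by positivity) (by positivity), e1, e2, e3, e4]
  push_cast
  ring

/-- if `F : mod(Q) → mod(Q')` is an exact `k`-linear functor
such that all induced maps `Ext¹_Q(U,V) → Ext¹_{Q'}(F U, F V)` are surjective
with equicardinal fibres, then `H(F)_* : [M] ↦ (a_{F M}/a_M)[F M]` is an
algebra homomorphism between the twisted Hall algebras
(`[U][V] = ∑_{[W]} q^{⟨dim U, dim V⟩_a} F_{UV}^W [W]`); stated on the basis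
elements, coefficientwise at `[W']`. -/
theorem statement14 (Q Q' : FinQuiver) (k : Type) [Field k] [Fintype k]
    (F : RepFunctor Q Q' k)
    (hsurj : ∀ U V : QRep Q k, Function.Surjective (extYoMap F U V))
    (hfib : ∀ (U V : QRep Q k) (c c' : ExtYo (F.obj U) (F.obj V)),
      Nat.card {e : ExtYo U V // extYoMap F U V e = c} =
        Nat.card {e : ExtYo U V // extYoMap F U V e = c'}) :
    ∀ (U V : QRep Q k) (W' : TotalClass Q' k),
      ((Fintype.card k : ℚ) ^ eulerFormN Q U.dimVec V.dimVec) *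
        ∑ᶠ c : TotalClass Q k,
          (hallNum U V c.rep : ℚ) *
            ((autCard (F.obj c.rep) : ℚ) / (autCard c.rep : ℚ)) *
            (if IsIsomorphic (F.obj c.rep) W'.rep then 1 else 0) =
      ((autCard (F.obj U) : ℚ) / (autCard U : ℚ)) *
        ((autCard (F.obj V) : ℚ) / (autCard V : ℚ)) *
        ((Fintype.card k : ℚ) ^
          eulerFormN Q' (F.obj U).dimVec (F.obj V).dimVec) *
        (hallNum (F.obj U) (F.obj V) W'.rep : ℚ) := by
  intro U V W'
  have aU : (autCard U : ℚ) ≠ 0 := by exact_mod_cast (autCard_pos U).ne'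
  have aV : (autCard V : ℚ) ≠ 0 := by exact_mod_cast (autCard_pos V).ne'
  have aFU : (autCard (F.obj U) : ℚ) ≠ 0 := by exact_mod_cast (autCard_pos (F.obj U)).ne'
  have aFV : (autCard (F.obj V) : ℚ) ≠ 0 := by exact_mod_cast (autCard_pos (F.obj V)).ne'
  have hp := proportion F hfib U V W'.rep
  have hr := riedtmann (F.obj U) (F.obj V) W'.rep
  choose cls hcls using exists_cls (Q := Q) (k := k)
  have hcls' : ∀ (M : QRep Q k) (c : TotalClass Q k), IsIsomorphic M c.rep ↔ c = cls M := by
    intro M c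
    constructor
    · intro h
      exact rep_inj (h.symm'.trans' (hcls M))
    · rintro rfl
      exact hcls M
  have := Fintype.ofFinite (Cochain U V)
  set q := (Fintype.card k : ℚ) ^ eulerFormN Q U.dimVec V.dimVec
  set ZC : ℚ := (Nat.card (Cochain U V) : ℚ)
  have hq : q ≠ 0 := zpow_ne_zero _ (by exact_mod_cast Fintype.card_ne_zero)
  have hZ : ZC ≠ 0 := by
    have : 0 < Nat.card (Cochain U V) := Nat.card_pos
    exact Nat.cast_ne_zero.2 this.ne'
  have hterm : ∀ c : TotalClass Q k, (hallNum U V c.rep : ℚ) *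
            ((autCard (F.obj c.rep) : ℚ) / (autCard c.rep : ℚ)) *
            (if IsIsomorphic (F.obj c.rep) W'.rep then 1 else 0) =
      ∑ z : Cochain U V, if c = cls (middle z) then
        (if IsIsomorphic (F.obj (middle z)) W'.rep then
          (autCard W'.rep : ℚ) / (q * ZC * (autCard U * autCard V)) else 0) else 0 := by
    intro c
    have hc := riedtmann U V c.rep
    have ac : (autCard c.rep : ℚ) ≠ 0 := by exact_mod_cast (autCard_pos c.rep).ne'
    have h1 : ∀ z : Cochain U V, (if c = cls (middle z) then
        (if IsIsomorphic (F.obj (middle z)) W'.rep then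
          (autCard W'.rep : ℚ) / (q * ZC * (autCard U * autCard V)) else 0) else 0) =
        (if IsIsomorphic (middle z) c.rep then (1 : ℚ) else 0) *
        (if IsIsomorphic (F.obj c.rep) W'.rep then
          (autCard W'.rep : ℚ) / (q * ZC * (autCard U * autCard V)) else 0) := by
      intro z
      by_cases hz : IsIsomorphic (middle z) c.rep
      · have hF := F_iso F hz
        have h2 : IsIsomorphic (F.obj (middle z)) W'.rep ↔
            IsIsomorphic (F.obj c.rep) W'.rep :=
          ⟨fun h => hF.symm'.trans' h, fun h => hF.trans' h⟩
        rw [if_pos ((hcls' _ _).1 hz), if_pos hz, one_mul]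
        simp only [h2]
      · rw [if_neg (fun h => hz ((hcls' _ _).2 h)), if_neg hz, zero_mul]
    rw [Finset.sum_congr rfl (fun z _ => h1 z), ← Finset.sum_mul, Finset.sum_boole,
      ← Fintype.card_subtype, ← Nat.card_eq_fintype_card]
    by_cases hW : IsIsomorphic (F.obj c.rep) W'.rep
    · rw [if_pos hW, if_pos hW, autCard_congr hW, mul_one]
      have hc' : (hallNum U V c.rep : ℚ) =
          (Nat.card {z : Cochain U V // IsIsomorphic (middle z) c.rep} : ℚ) * autCard c.rep /
            (q * ZC * (autCard U * autCard V)) := by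
        rw [eq_div_iff (by positivity)]
        have : q * (hallNum U V c.rep : ℚ) * ((autCard U : ℚ) * autCard V) * ZC =
            (Nat.card {z : Cochain U V // IsIsomorphic (middle z) c.rep} : ℚ) * autCard c.rep := by
          rw [hc]
          exact div_mul_cancel₀ _ hZ
        rw [← this]
        ring
      rw [hc']
      field_simp
    · rw [if_neg hW, if_neg hW, mul_zero, mul_zero]
  have hsum : ∑ᶠ c : TotalClass Q k, (hallNum U V c.rep : ℚ) *
            ((autCard (F.obj c.rep) : ℚ) / (autCard c.rep : ℚ)) *
            (if IsIsomorphic (F.obj c.rep) W'.rep then 1 else 0) =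
      (Nat.card {z : Cochain U V // IsIsomorphic (F.obj (middle z)) W'.rep} : ℚ) *
        ((autCard W'.rep : ℚ) / (q * ZC * (autCard U * autCard V))) := by
    rw [finsum_congr hterm, finsum_sum_comm]
    · rw [Finset.sum_congr rfl (fun z _ => finsum_eq_single _ (cls (middle z))
        (fun c hc => if_neg hc))]
      simp only [if_true]
      rw [← Finset.sum_filter, Finset.sum_const, nsmul_eq_mul, ← Fintype.card_subtype,
        ← Nat.card_eq_fintype_card]
    · intro z _
      refine (Set.finite_singleton (cls (middle z))).subset fun c hc => ?_
      by_contra h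
      exact hc (if_neg h)
  rw [hsum]
  rw [show ((autCard (F.obj U) : ℚ) / (autCard U : ℚ)) *
        ((autCard (F.obj V) : ℚ) / (autCard V : ℚ)) *
        ((Fintype.card k : ℚ) ^
          eulerFormN Q' (F.obj U).dimVec (F.obj V).dimVec) *
        (hallNum (F.obj U) (F.obj V) W'.rep : ℚ) =
      ((Fintype.card k : ℚ) ^ eulerFormN Q' (F.obj U).dimVec (F.obj V).dimVec *
        (hallNum (F.obj U) (F.obj V) W'.rep : ℚ) *
        ((autCard (F.obj U) : ℚ) * (autCard (F.obj V) : ℚ))) /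
        ((autCard U : ℚ) * (autCard V : ℚ)) by field_simp, hr, mul_div_right_comm, ← hp]
  field_simp


end HallPaper
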